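/- There exists an absolute constant C > 0 such that for every finite set P of n points and every finite set L of m lines in ℝ², the number of incidences satisfies |I(P,L)| ≤ C(n^{2/3} m^{2/3} + n + m). -/

import Mathlib

/-- `l ⊆ ℝ²` is a line if it is the solution set of a nontrivial affine equation. -/
def IsLine (l : Set (ℝ × ℝ)) : Prop :=
  ∃ a b c : ℝ, (a, b) ≠ (0, 0) ∧ l = {p : ℝ × ℝ | a * p.1 + b * p.2 = c}

/-- The set of incidences between a set of points `P` and a set of lines `L`. -/
def Incidences (P : Set (ℝ × ℝ)) (L : Set (Set (ℝ × ℝ))) :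
    Set ((ℝ × ℝ) × Set (ℝ × ℝ)) :=
  {pl | pl.1 ∈ P ∧ pl.2 ∈ L ∧ pl.1 ∈ pl.2}

/-- Points with coordinates `x`, `y`, and edges joining a `left` to a `right` point along the graph
of `t ↦ slope * t + icpt`. -/
structure Drawing (α ι : Type*) where
  x : α → ℝ
  y : α → ℝ
  left : ι → α
  right : ι → α
  slope : ι → ℝ
  icpt : ι → ℝ

namespace Drawing

variable {α ι : Type*} (D : Drawing α ι)

/-- The height at abscissa `t` of the line carrying the edge `i`. -/
def height (i : ι) (t : ℝ) : ℝ := D.slope i * t + D.icpt i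

/-- `t` is the abscissa of a relative interior point of the edge `i`. -/
def Inside (i : ι) (t : ℝ) : Prop := D.x (D.left i) < t ∧ t < D.x (D.right i)

/-- Two distinct edges cross if they share a relative interior point. -/
def Cross (i j : ι) : Prop :=
  i ≠ j ∧ ∃ t, D.Inside i t ∧ D.Inside j t ∧ D.height i t = D.height j t

/-- The edges `E` form a straight-line drawing of a simple graph on the vertices `V`, which have
distinct abscissas; no vertex lies in the relative interior of an edge. -/
structure IsGraph (V : Finset α) (E : Finset ι) : Prop where
  injOn : Set.InjOn D.x V
  left_mem : ∀ i ∈ E, D.left i ∈ V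
  right_mem : ∀ i ∈ E, D.right i ∈ V
  lt : ∀ i ∈ E, D.x (D.left i) < D.x (D.right i)
  y_left : ∀ i ∈ E, D.y (D.left i) = D.height i (D.x (D.left i))
  y_right : ∀ i ∈ E, D.y (D.right i) = D.height i (D.x (D.right i))
  not_inside : ∀ i ∈ E, ∀ p ∈ V, D.Inside i (D.x p) → D.y p ≠ D.height i (D.x p)
  simple : ∀ i ∈ E, ∀ j ∈ E, D.left i = D.left j → D.right i = D.right j → i = j

variable {D} {V V' : Finset α} {E E' : Finset ι}

lemma IsGraph.mono (h : D.IsGraph V E) (hV : V' ⊆ V) (hE : E' ⊆ E)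
    (hl : ∀ i ∈ E', D.left i ∈ V') (hr : ∀ i ∈ E', D.right i ∈ V') : D.IsGraph V' E' where
  injOn := h.injOn.mono (by exact_mod_cast hV)
  left_mem := hl
  right_mem := hr
  lt i hi := h.lt i (hE hi)
  y_left i hi := h.y_left i (hE hi)
  y_right i hi := h.y_right i (hE hi)
  not_inside i hi p hp := h.not_inside i (hE hi) p (hV hp)
  simple i hi j hj := h.simple i (hE hi) j (hE hj)

lemma height_le_of_not_cross {i j : ι} {s t : ℝ} (hc : ¬ D.Cross i j) (hst : s < t)
    (his : D.x (D.left i) ≤ s) (hit : t ≤ D.x (D.right i))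
    (hjs : D.x (D.left j) ≤ s) (hjt : t ≤ D.x (D.right j))
    (hs : D.height i s < D.height j s) : D.height i t ≤ D.height j t := by
  by_contra! ht
  refine hc ⟨fun h => by subst h; exact lt_irrefl _ hs, ?_⟩
  simp only [height] at hs ht
  have hm : 0 < D.slope i - D.slope j := by
    by_contra! h
    nlinarith
  set z := (D.icpt j - D.icpt i) / (D.slope i - D.slope j) with hz
  have hsz : s < z := by rw [hz, lt_div_iff₀ hm]; linarith
  have hzt : z < t := by rw [hz, div_lt_iff₀ hm]; linarith
  refine ⟨z, ⟨by linarith, by linarith⟩, ⟨by linarith, by linarith⟩, ?_⟩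
  have : z * (D.slope i - D.slope j) = D.icpt j - D.icpt i := div_mul_cancel₀ _ hm.ne'
  simp only [height]
  linarith

lemma slope_eq_icpt_eq {i j : ι} {s t : ℝ} (hst : s ≠ t) (hs : D.height i s = D.height j s)
    (ht : D.height i t = D.height j t) : D.slope i = D.slope j ∧ D.icpt i = D.icpt j := by
  simp only [height] at hs ht
  have : D.slope i = D.slope j := by
    have : (D.slope i - D.slope j) * (s - t) = 0 := by linarith
    rcases mul_eq_zero.1 this with h | h
    · linarith
    · exact absurd (by linarith) hst
  refine ⟨this, ?_⟩
  rw [this] at hs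
  linarith

namespace IsGraph

/-- Overlapping edges on the same line coincide. -/
lemma eq_of_line_eq (h : D.IsGraph V E)
    {i j : ι} (hi : i ∈ E) (hj : j ∈ E) (hs : D.slope i = D.slope j)
    (hk : D.icpt i = D.icpt j) {t : ℝ} (hit : D.Inside i t) (hjt : D.Inside j t) : i = j := by
  have hh : ∀ s, D.height i s = D.height j s := fun s => by simp only [height, hs, hk]
  obtain ⟨h1, h2⟩ := hit
  obtain ⟨h3, h4⟩ := hjt
  refine h.simple i hi j hj ?_ ?_
  · refine h.injOn (h.left_mem i hi) (h.left_mem j hj) ?_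
    rcases lt_trichotomy (D.x (D.left i)) (D.x (D.left j)) with hlt | heq | hlt
    · exact absurd ((h.y_left j hj).trans (hh _).symm)
        (h.not_inside i hi _ (h.left_mem j hj) ⟨hlt, by linarith⟩)
    · exact heq
    · exact absurd ((h.y_left i hi).trans (hh _))
        (h.not_inside j hj _ (h.left_mem i hi) ⟨hlt, by linarith⟩)
  · refine h.injOn (h.right_mem i hi) (h.right_mem j hj) ?_
    rcases lt_trichotomy (D.x (D.right i)) (D.x (D.right j)) with hlt | heq | hlt
    · exact absurd ((h.y_right i hi).trans (hh _))
        (h.not_inside j hj _ (h.right_mem i hi) ⟨by linarith, hlt⟩)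
    · exact heq
    · exact absurd ((h.y_right j hj).trans (hh _).symm)
        (h.not_inside i hi _ (h.right_mem j hj) ⟨by linarith, hlt⟩)

lemma eq_of_left_eq (h : D.IsGraph V E)
    {i j : ι} (hi : i ∈ E) (hj : j ∈ E) (hl : D.left i = D.left j)
    (hs : D.slope i = D.slope j) : i = j := by
  have hk : D.icpt i = D.icpt j := by
    have h1 := h.y_left i hi
    have h2 := h.y_left j hj
    simp only [height, hl, hs] at h1 h2
    linarith
  have h1 := h.lt i hi
  have h2 := h.lt j hj
  rw [hl] at h1
  obtain ⟨t, ht1, ht2⟩ := exists_between (lt_min h1 h2)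
  rw [lt_min_iff] at ht2
  exact h.eq_of_line_eq hi hj hs hk ⟨by rwa [hl], ht2.1⟩ ⟨ht1, ht2.2⟩

lemma eq_of_right_eq (h : D.IsGraph V E)
    {i j : ι} (hi : i ∈ E) (hj : j ∈ E) (hr : D.right i = D.right j)
    (hs : D.slope i = D.slope j) : i = j := by
  have hk : D.icpt i = D.icpt j := by
    have h1 := h.y_right i hi
    have h2 := h.y_right j hj
    simp only [height, hr, hs] at h1 h2
    linarith
  have h1 := h.lt i hi
  have h2 := h.lt j hj
  rw [hr] at h1
  obtain ⟨t, ht1, ht2⟩ := exists_between (max_lt h1 h2)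
  rw [max_lt_iff] at ht1
  exact h.eq_of_line_eq hi hj hs hk ⟨ht1.1, by rwa [hr]⟩ ⟨ht1.2, ht2⟩

lemma line_ne_of_cross (h : D.IsGraph V E)
    {i j : ι} (hi : i ∈ E) (hj : j ∈ E) (hc : D.Cross i j) :
    ¬ (D.slope i = D.slope j ∧ D.icpt i = D.icpt j) := fun ⟨hs, hk⟩ => by
  obtain ⟨hij, t, hit, hjt, -⟩ := hc
  exact hij (h.eq_of_line_eq hi hj hs hk hit hjt)

/-- Crossing edges have four distinct endpoints. -/
lemma card_endpoints_of_cross [DecidableEq α] (h : D.IsGraph V E)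
    {i j : ι} (hi : i ∈ E) (hj : j ∈ E)
    (hc : D.Cross i j) :
    ({D.left i, D.right i, D.left j, D.right j} : Finset α).card = 4 := by
  have hne := h.line_ne_of_cross hi hj hc
  obtain ⟨-, t, ⟨h1, h2⟩, ⟨h3, h4⟩, ht⟩ := hc
  have hll : D.left i ≠ D.left j := fun he => hne <| slope_eq_icpt_eq h1.ne
    (by rw [← h.y_left i hi, he, h.y_left j hj]) ht
  have hrr : D.right i ≠ D.right j := fun he => hne <| slope_eq_icpt_eq h2.ne'
    (by rw [← h.y_right i hi, he, h.y_right j hj]) ht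
  have hi' : D.left i ≠ D.right i := fun he => by rw [he] at h1; linarith
  have hj' : D.left j ≠ D.right j := fun he => by rw [he] at h3; linarith
  have hlr : D.left i ≠ D.right j := fun he => by rw [he] at h1; linarith
  have hrl : D.right i ≠ D.left j := fun he => by rw [he] at h2; linarith
  rw [Finset.card_insert_of_notMem, Finset.card_insert_of_notMem, Finset.card_insert_of_notMem,
    Finset.card_singleton] <;> simp [*]

/-- In a drawing without crossings, an edge that is neither the highest edge to the left of its
right endpoint nor the highest edge to the right of its left endpoint is directly below some
vertex. -/
lemma exists_vertex_above (h : D.IsGraph V E)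
    (hc : ∀ i ∈ E, ∀ j ∈ E, ¬ D.Cross i j) {i : ι} (hi : i ∈ E)
    (hright : ∃ j ∈ E, D.right j = D.right i ∧ D.slope j < D.slope i)
    (hleft : ∃ j ∈ E, D.left j = D.left i ∧ D.slope i < D.slope j) :
    ∃ w ∈ V, D.Inside i (D.x w) ∧ D.height i (D.x w) < D.y w ∧
      ∀ g ∈ E, D.x (D.left g) ≤ D.x w → D.x w < D.x (D.right g) → D.height g (D.x w) < D.y w →
        D.height g (D.x w) ≤ D.height i (D.x w) := by
  classical
  obtain ⟨j, hj, hjmax⟩ := (E.filter fun j => D.right j = D.right i ∧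
    D.slope j < D.slope i).exists_max_image D.slope (by
      obtain ⟨j, hj, hj'⟩ := hright
      exact ⟨j, Finset.mem_filter.2 ⟨hj, hj'⟩⟩)
  obtain ⟨hj, hjr, hjs⟩ := Finset.mem_filter.1 hj
  have hij : D.height i (D.x (D.right i)) = D.height j (D.x (D.right i)) := by
    rw [← h.y_right i hi, ← hjr, h.y_right j hj]
  have hlt_of : ∀ t < D.x (D.right i), D.height i t < D.height j t := fun t ht => by
    simp only [height] at hij ⊢
    nlinarith
  set W := V.filter fun p => D.x (D.left i) ≤ D.x p ∧ D.x (D.left j) ≤ D.x p ∧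
    D.x p < D.x (D.right i) ∧ D.height i (D.x p) ≤ D.y p ∧ D.y p ≤ D.height j (D.x p)
  obtain ⟨w, hwW, hwmax⟩ := W.exists_max_image D.x (by
    rcases le_total (D.x (D.left j)) (D.x (D.left i)) with hle | hle
    · refine ⟨D.left i, Finset.mem_filter.2 ⟨h.left_mem i hi, le_rfl, hle, h.lt i hi,
        (h.y_left i hi).ge, ?_⟩⟩
      rw [h.y_left i hi]
      exact (hlt_of _ (h.lt i hi)).le
    · have := hjr ▸ h.lt j hj
      refine ⟨D.left j, Finset.mem_filter.2 ⟨h.left_mem j hj, hle, le_rfl, this, ?_,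
        (h.y_left j hj).le⟩⟩
      rw [h.y_left j hj]
      exact (hlt_of _ this).le)
  obtain ⟨hwV, hiw, hjw, hwr, hwi, hwj⟩ := Finset.mem_filter.1 hwW
  have hjr' : D.x (D.right j) = D.x (D.right i) := by rw [hjr]
  have trapped : ∀ g ∈ E, D.x (D.left g) ≤ D.x w → D.x w < D.x (D.right g) →
      D.height g (D.x w) < D.height j (D.x w) →
      (∀ t, D.x w < t → t ≤ D.x (D.right g) → t ≤ D.x (D.right i) →
        D.height i t ≤ D.height g t) →
      D.height i (D.x w) ≤ D.height g (D.x w) →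
      (D.height i (D.x w) < D.height g (D.x w) ∨ D.slope i < D.slope g) → False := by
    intro g hg hgl hgr hgj hgi hgiw hgs
    have hgj' : ∀ t, D.x w < t → t ≤ D.x (D.right g) → t ≤ D.x (D.right i) →
        D.height g t ≤ D.height j t := fun t ht htg hti =>
      height_le_of_not_cross (hc g hg j hj) ht hgl htg hjw (by linarith) hgj
    rcases lt_trichotomy (D.x (D.right g)) (D.x (D.right i)) with hlt | heq | hgt
    · have : D.x (D.right g) ≤ D.x w := hwmax _ (Finset.mem_filter.2 ⟨h.right_mem g hg,
        by linarith, by linarith, hlt, by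
          rw [h.y_right g hg]; exact hgi _ hgr le_rfl hlt.le, by
          rw [h.y_right g hg]; exact hgj' _ hgr le_rfl hlt.le⟩)
      linarith
    · have hge : D.right g = D.right i := h.injOn (h.right_mem g hg) (h.right_mem i hi) heq
      have hgh : D.height g (D.x (D.right i)) = D.height i (D.x (D.right i)) := by
        rw [← h.y_right i hi, ← hge, h.y_right g hg]
      simp only [height] at hgj hgiw hgh hij
      have h1 : D.slope g < D.slope i := by
        simp only [height] at hgs
        by_contra! hh
        rcases hgs with hgs | hgs <;> nlinarith
      have h2 : D.slope j < D.slope g := by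
        by_contra! hh
        nlinarith
      have := hjmax g (Finset.mem_filter.2 ⟨hg, hge, h1⟩)
      linarith
    · refine h.not_inside g hg _ (h.right_mem i hi) ⟨by linarith, hgt⟩ ?_
      have h1 := hgi _ hwr hgt.le le_rfl
      have h2 := hgj' _ hwr hgt.le le_rfl
      rw [h.y_right i hi]
      linarith
  have hwl : D.x (D.left i) < D.x w := by
    refine lt_of_le_of_ne hiw fun heq => ?_
    obtain ⟨g, hg, hgl, hgs⟩ := hleft
    have hgl' : D.x (D.left g) = D.x w := by rw [hgl, heq]
    have hgw : D.height g (D.x w) = D.height i (D.x w) := by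
      rw [← hgl', ← h.y_left g hg, hgl, h.y_left i hi]
    refine trapped g hg hgl'.le (hgl' ▸ h.lt g hg) (hgw ▸ hlt_of _ hwr) (fun t ht _ _ => ?_)
      hgw.ge (Or.inr hgs)
    simp only [height] at hgw ⊢
    nlinarith
  refine ⟨w, hwV, ⟨hwl, hwr⟩, lt_of_le_of_ne hwi
    (h.not_inside i hi w hwV ⟨hwl, hwr⟩).symm, fun g hg hgl hgr hgw => ?_⟩
  by_contra! hig
  have key : ∀ t, D.x w < t → t ≤ D.x (D.right g) → t ≤ D.x (D.right i) →
      D.height i t ≤ D.height g t := fun t ht htg hti =>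
    height_le_of_not_cross (hc i hi g hg) ht hiw hti hgl htg hig
  exact trapped g hg hgl hgr (by linarith) key hig.le (Or.inl hig)

/-- A planar straight-line drawing has at most three times as many edges as vertices. -/
lemma card_le_of_not_cross (h : D.IsGraph V E)
    (hc : ∀ i ∈ E, ∀ j ∈ E, ¬ D.Cross i j) : E.card ≤ 3 * V.card := by
  classical
  set A := E.filter fun i => ∀ j ∈ E, D.right j = D.right i → D.slope i ≤ D.slope j with hA
  set B := E.filter fun i => ∀ j ∈ E, D.left j = D.left i → D.slope j ≤ D.slope i with hB
  set C := E.filter fun i => ∃ w ∈ V, D.Inside i (D.x w) ∧ D.height i (D.x w) < D.y w ∧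
    ∀ g ∈ E, D.x (D.left g) ≤ D.x w → D.x w < D.x (D.right g) → D.height g (D.x w) < D.y w →
      D.height g (D.x w) ≤ D.height i (D.x w) with hC
  have hcover : E ⊆ A ∪ B ∪ C := fun i hi => by
    simp only [Finset.mem_union]
    by_contra! hn
    obtain ⟨⟨hnA, hnB⟩, hnC⟩ := hn
    simp only [hA, hB, Finset.mem_filter, hi, true_and, not_forall, not_le, exists_prop]
      at hnA hnB
    exact hnC (Finset.mem_filter.2 ⟨hi, h.exists_vertex_above hc hi hnA hnB⟩)
  have hAV : A.card ≤ V.card := by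
    refine Finset.card_le_card_of_injOn D.right
      (fun i hi => h.right_mem i (Finset.mem_filter.1 hi).1) fun i hi j hj hij => ?_
    obtain ⟨hi, hi'⟩ := Finset.mem_filter.1 hi
    obtain ⟨hj, hj'⟩ := Finset.mem_filter.1 hj
    exact h.eq_of_right_eq hi hj hij (le_antisymm (hi' j hj hij.symm) (hj' i hi hij))
  have hBV : B.card ≤ V.card := by
    refine Finset.card_le_card_of_injOn D.left
      (fun i hi => h.left_mem i (Finset.mem_filter.1 hi).1) fun i hi j hj hij => ?_
    obtain ⟨hi, hi'⟩ := Finset.mem_filter.1 hi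
    obtain ⟨hj, hj'⟩ := Finset.mem_filter.1 hj
    exact h.eq_of_left_eq hi hj hij (le_antisymm (hj' i hi hij) (hi' j hj hij.symm))
  have hCV : C.card ≤ V.card := by
    refine Finset.card_le_card_of_forall_subsingleton
      (fun i w => D.Inside i (D.x w) ∧ D.height i (D.x w) < D.y w ∧
        ∀ g ∈ E, D.x (D.left g) ≤ D.x w → D.x w < D.x (D.right g) →
          D.height g (D.x w) < D.y w → D.height g (D.x w) ≤ D.height i (D.x w))
      (fun i hi => (Finset.mem_filter.1 hi).2) ?_
    rintro w - i ⟨hi, hi1, hi2, hi3⟩ j ⟨hj, hj1, hj2, hj3⟩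
    have hiE := (Finset.mem_filter.1 hi).1
    have hjE := (Finset.mem_filter.1 hj).1
    by_contra hne
    exact hc i hiE j hjE ⟨hne, _, hi1, hj1, le_antisymm
      (hj3 i hiE hi1.1.le hi1.2 hi2) (hi3 j hjE hj1.1.le hj1.2 hj2)⟩
  have := Finset.card_le_card hcover
  have := Finset.card_union_le (A ∪ B) C
  have := Finset.card_union_le A B
  omega

end IsGraph

open scoped Classical in
/-- The ordered pairs of crossing edges. -/
noncomputable def crossings (D : Drawing α ι) (E : Finset ι) : Finset (ι × ι) :=
  (E ×ˢ E).filter fun p => D.Cross p.1 p.2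

lemma mem_crossings {p : ι × ι} :
    p ∈ D.crossings E ↔ p.1 ∈ E ∧ p.2 ∈ E ∧ D.Cross p.1 p.2 := by
  simp [crossings, and_assoc]

lemma IsGraph.card_le_add_card_crossings (h : D.IsGraph V E) :
    E.card ≤ 3 * V.card + (D.crossings E).card := by
  classical
  induction E using Finset.strongInduction with
  | H E ih =>
    by_cases hc : ∀ i ∈ E, ∀ j ∈ E, ¬ D.Cross i j
    · exact (h.card_le_of_not_cross hc).trans (Nat.le_add_right _ _)
    push Not at hc
    obtain ⟨i, hi, j, hj, hij⟩ := hc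
    have hsub := Finset.erase_subset i E
    have h1 := ih (E.erase i) (Finset.erase_ssubset hi) (h.mono subset_rfl hsub
      (fun a ha => h.left_mem a (hsub ha)) fun a ha => h.right_mem a (hsub ha))
    have h2 : (D.crossings (E.erase i)).card < (D.crossings E).card := by
      refine Finset.card_lt_card (Finset.ssubset_iff_subset_ne.2 ⟨fun p hp => ?_, fun he => ?_⟩)
      · obtain ⟨hp1, hp2, hp⟩ := mem_crossings.1 hp
        exact mem_crossings.2 ⟨hsub hp1, hsub hp2, hp⟩
      · have : (i, j) ∈ D.crossings E := mem_crossings.2 ⟨hi, hj, hij⟩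
        rw [← he] at this
        exact Finset.notMem_erase i E (mem_crossings.1 this).1
    have h3 := Finset.card_erase_add_one hi
    omega

end Drawing

section Sampling

variable {α β : Type*} [Fintype α] [DecidableEq α] {k : ℕ} [NeZero k]

lemma card_filter_forall_eq_zero (A : Finset α) :
    (Finset.univ.filter fun f : α → Fin k => ∀ a ∈ A, f a = 0).card * k ^ A.card =
      k ^ Fintype.card α := by
  have : (Finset.univ.filter fun f : α → Fin k => ∀ a ∈ A, f a = 0) =
      Fintype.piFinset fun a => if a ∈ A then {0} else Finset.univ := by
    ext f
    simp only [Finset.mem_filter, Finset.mem_univ, true_and, Fintype.mem_piFinset]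
    refine forall_congr' fun a => ?_
    by_cases ha : a ∈ A <;> simp [ha]
  have hpow : k ^ A.card = ∏ a, if a ∈ A then k else 1 := by simp
  rw [this, Fintype.card_piFinset, hpow, ← Finset.prod_mul_distrib, ← Finset.card_univ,
    ← Finset.prod_const]
  refine Finset.prod_congr rfl fun a _ => ?_
  by_cases ha : a ∈ A <;> simp [ha]

lemma sum_card_filter_forall_eq_zero (S : Finset β) (A : β → Finset α) {c : ℕ}
    (hA : ∀ b ∈ S, (A b).card = c) :
    (∑ f : α → Fin k, (S.filter fun b => ∀ a ∈ A b, f a = 0).card) * k ^ c =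
      S.card * k ^ Fintype.card α := by
  simp_rw [Finset.card_filter]
  rw [Finset.sum_comm, Finset.sum_mul, Finset.card_eq_sum_ones, Finset.sum_mul]
  refine Finset.sum_congr rfl fun b hb => ?_
  rw [← Finset.card_filter, ← hA b hb, card_filter_forall_eq_zero, one_mul]

end Sampling

namespace Drawing

variable {α ι : Type*} [Fintype α] {D : Drawing α ι} {E : Finset ι}

/-- The crossing inequality, with the sampling probability `1 / k`. -/
lemma IsGraph.card_mul_sq_le (h : D.IsGraph Finset.univ E) {k : ℕ} (hk : 0 < k) :
    E.card * k ^ 2 ≤ 3 * Fintype.card α * k ^ 3 + (D.crossings E).card := by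
  classical
  have : NeZero k := ⟨hk.ne'⟩
  have hV := sum_card_filter_forall_eq_zero (k := k) (Finset.univ : Finset α) (fun p => {p})
    (c := 1) fun _ _ => Finset.card_singleton _
  have hE := sum_card_filter_forall_eq_zero (k := k) E (fun i => {D.left i, D.right i})
    (c := 2) fun i hi => Finset.card_pair fun he => (h.lt i hi).ne (by rw [he])
  have hX := sum_card_filter_forall_eq_zero (k := k) (D.crossings E)
    (fun p => {D.left p.1, D.right p.1, D.left p.2, D.right p.2}) (c := 4) fun p hp => by
      obtain ⟨h1, h2, h3⟩ := mem_crossings.1 hp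
      exact h.card_endpoints_of_cross h1 h2 h3
  rw [Finset.card_univ] at hV
  have hle := Finset.sum_le_sum fun (f : α → Fin k) (_ : f ∈ Finset.univ) =>
    show (E.filter fun i => ∀ a ∈ ({D.left i, D.right i} : Finset α), f a = 0).card ≤
      3 * (Finset.univ.filter fun p => ∀ a ∈ ({p} : Finset α), f a = 0).card +
        ((D.crossings E).filter fun p => ∀ a ∈
          ({D.left p.1, D.right p.1, D.left p.2, D.right p.2} : Finset α), f a = 0).card by
      refine (IsGraph.card_le_add_card_crossings (D := D) (h.mono (Finset.subset_univ _)
        (Finset.filter_subset _ _) (fun i hi => ?_) fun i hi => ?_)).trans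
        (Nat.add_le_add_left (Finset.card_le_card fun p hp => ?_) _)
      · simpa using (Finset.mem_filter.1 hi).2 (D.left i) (by simp)
      · simpa using (Finset.mem_filter.1 hi).2 (D.right i) (by simp)
      · obtain ⟨h1, h2, h3⟩ := mem_crossings.1 hp
        obtain ⟨h1, h1'⟩ := Finset.mem_filter.1 h1
        obtain ⟨h2, h2'⟩ := Finset.mem_filter.1 h2
        refine Finset.mem_filter.2 ⟨mem_crossings.2 ⟨h1, h2, h3⟩, ?_⟩
        simp only [Finset.mem_insert, Finset.mem_singleton, forall_eq_or_imp, forall_eq]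
          at h1' h2' ⊢
        exact ⟨h1'.1, h1'.2, h2'.1, h2'.2⟩
  rw [Finset.sum_add_distrib, ← Finset.mul_sum] at hle
  refine Nat.le_of_mul_le_mul_right ?_ (pow_pos hk (Fintype.card α))
  calc E.card * k ^ 2 * k ^ Fintype.card α
      = (E.card * k ^ Fintype.card α) * k ^ 2 := by ring
    _ ≤ 3 * (Fintype.card α * k ^ Fintype.card α) * k ^ 3 +
          (D.crossings E).card * k ^ Fintype.card α := by
        rw [← hV, ← hE, ← hX]
        refine (le_of_eq (by ring)).trans ((Nat.mul_le_mul_right (k ^ 4) hle).trans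
          (le_of_eq (by ring)))
    _ = _ := by ring

/-- The crossing lemma for straight-line drawings. -/
lemma IsGraph.card_pow_three_le (h : D.IsGraph Finset.univ E)
    (hE : 6 * Fintype.card α ≤ E.card) :
    E.card ^ 3 ≤ 288 * Fintype.card α ^ 2 * (D.crossings E).card := by
  rcases Nat.eq_zero_or_pos (Fintype.card α) with hn | hn
  · have : E = ∅ := Finset.eq_empty_of_forall_notMem fun i _ =>
      (Fintype.card_eq_zero_iff.1 hn).false (D.left i)
    simp [this]
  set n := Fintype.card α
  set k := E.card / (6 * n)
  have hk : 0 < k := Nat.div_pos hE (by omega)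
  have h1 : k * (6 * n) ≤ E.card := Nat.div_mul_le_self _ _
  have h2 : E.card < (k + 1) * (6 * n) := by
    rw [mul_comm]
    exact Nat.lt_mul_div_succ _ (by omega)
  have h3 : E.card ≤ 12 * n * k := by nlinarith
  have h4 := h.card_mul_sq_le hk
  have h5 : E.card * k ^ 2 ≤ 2 * (D.crossings E).card := by
    have := Nat.mul_le_mul_right (k ^ 2) h1
    nlinarith
  calc E.card ^ 3 = E.card * E.card ^ 2 := by ring
    _ ≤ E.card * (12 * n * k) ^ 2 := by gcongr
    _ = 144 * n ^ 2 * (E.card * k ^ 2) := by ring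
    _ ≤ 144 * n ^ 2 * (2 * (D.crossings E).card) := by gcongr
    _ = _ := by ring

end Drawing

/-- A finite point set can be sheared so that its points have distinct abscissas. -/
lemma exists_shear_injOn (P : Finset (ℝ × ℝ)) :
    ∃ t : ℝ, Set.InjOn (fun p : ℝ × ℝ => p.1 + t * p.2) P := by
  obtain ⟨t, ht⟩ := Infinite.exists_notMem_finset
    ((P ×ˢ P).image fun pq => (pq.2.1 - pq.1.1) / (pq.1.2 - pq.2.2))
  refine ⟨t, fun p hp q hq hpq => ?_⟩
  simp only at hpq
  by_cases hy : p.2 = q.2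
  · rw [hy] at hpq
    exact Prod.ext (by linarith) hy
  · refine absurd (Finset.mem_image.2 ⟨(p, q), Finset.mk_mem_product hp hq, ?_⟩) ht
    rw [div_eq_iff (sub_ne_zero.2 hy)]
    linarith

lemma IsLine.exists_slope {l : Set (ℝ × ℝ)} (hl : IsLine l) {t : ℝ} {p q : ℝ × ℝ} (hp : p ∈ l)
    (hq : q ∈ l) (hpq : p.1 + t * p.2 ≠ q.1 + t * q.2) :
    ∃ m k : ℝ, ∀ r : ℝ × ℝ, r ∈ l ↔ r.2 = m * (r.1 + t * r.2) + k := by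
  obtain ⟨a, b, c, hab, rfl⟩ := hl
  simp only [Set.mem_ofPred_eq] at hp hq ⊢
  have hd : b - a * t ≠ 0 := by
    intro hd
    have : a * ((p.1 + t * p.2) - (q.1 + t * q.2)) = 0 := by
      linear_combination hp - hq + (q.2 - p.2) * hd
    rcases mul_eq_zero.1 this with ha | h
    · subst ha
      exact hab (by simpa using hd)
    · exact hpq (sub_eq_zero.1 h)
  refine ⟨-a / (b - a * t), c / (b - a * t), fun r => ?_⟩
  rw [div_mul_eq_mul_div, ← add_div, eq_div_iff hd]
  constructor <;> intro h <;> linarith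

/-- Joining consecutive points on each line turns all but one incidence per line into edges of a
straight-line drawing, in which any two lines contribute at most one crossing. -/
lemma exists_edges (P : Finset (ℝ × ℝ)) (L : Finset (Set (ℝ × ℝ))) (hL : ∀ l ∈ L, IsLine l) :
    ∃ e : ℕ, (Incidences P L).ncard ≤ e + L.card ∧
      (6 * P.card ≤ e → e ^ 3 ≤ 288 * P.card ^ 2 * L.card ^ 2) := by
  classical
  obtain ⟨t, ht⟩ := exists_shear_injOn P
  set x : ℝ × ℝ → ℝ := fun p => p.1 + t * p.2
  have hinj : ∀ p q : P, x p = x q → p = q := fun p q h => Subtype.ext (ht p.2 q.2 h)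
  set I : Finset (P × Set (ℝ × ℝ)) := (Finset.univ ×ˢ L).filter fun i => i.1.1 ∈ i.2 with hI
  have hmemI : ∀ i, i ∈ I ↔ i.2 ∈ L ∧ i.1.1 ∈ i.2 := fun i => by simp [hI]
  set E := I.filter fun i => ∃ q : P, q.1 ∈ i.2 ∧ x i.1 < x q with hE
  have hmemE : ∀ i, i ∈ E ↔ (i.2 ∈ L ∧ i.1.1 ∈ i.2) ∧ ∃ q : P, q.1 ∈ i.2 ∧ x i.1 < x q :=
    fun i => by rw [hE, Finset.mem_filter, hmemI]
  have hnext : ∀ i : P × Set (ℝ × ℝ), ∃ q : P, i ∈ E → q.1 ∈ i.2 ∧ x i.1 < x q ∧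
      ∀ r : P, r.1 ∈ i.2 → x i.1 < x r → x q ≤ x r := by
    intro i
    by_cases hi : i ∈ E
    · obtain ⟨q, hq, hmin⟩ := Finset.exists_min_image
        (Finset.univ.filter fun q : P => q.1 ∈ i.2 ∧ x i.1 < x q) (fun q => x q) (by
          obtain ⟨q, hq⟩ := ((hmemE i).1 hi).2
          exact ⟨q, by simpa using hq⟩)
      simp only [Finset.mem_filter, Finset.mem_univ, true_and] at hq hmin
      exact ⟨q, fun _ => ⟨hq.1, hq.2, fun r h1 h2 => hmin r ⟨h1, h2⟩⟩⟩
    · exact ⟨i.1, fun h => absurd h hi⟩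
  choose next hnext using hnext
  have hslope : ∀ l : Set (ℝ × ℝ), ∃ m k : ℝ, (∃ i ∈ E, i.2 = l) →
      ∀ r : ℝ × ℝ, r ∈ l ↔ r.2 = m * x r + k := by
    intro l
    by_cases hl : ∃ i ∈ E, i.2 = l
    · obtain ⟨i, hi, rfl⟩ := hl
      obtain ⟨⟨h1, h2⟩, q, h3, h4⟩ := (hmemE i).1 hi
      obtain ⟨m, k, hmk⟩ := (hL _ h1).exists_slope h2 h3 h4.ne
      exact ⟨m, k, fun _ => hmk⟩
    · exact ⟨0, 0, fun h => absurd h hl⟩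
  choose m k hmk using hslope
  have hline : ∀ i ∈ E, ∀ r : ℝ × ℝ, r ∈ i.2 ↔ r.2 = m i.2 * x r + k i.2 :=
    fun i hi => hmk i.2 ⟨i, hi, rfl⟩
  have hline_eq : ∀ i ∈ E, ∀ j ∈ E, m i.2 = m j.2 → k i.2 = k j.2 → i.2 = j.2 :=
    fun i hi j hj h1 h2 => Set.ext fun r => by rw [hline i hi, hline j hj, h1, h2]
  let D : Drawing P (P × Set (ℝ × ℝ)) :=
    { x := fun p => x p, y := fun p => p.1.2, left := Prod.fst, right := next,
      slope := fun i => m i.2, icpt := fun i => k i.2 }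
  have hD : D.IsGraph Finset.univ E :=
    { injOn := fun p _ q _ h => hinj p q h
      left_mem := fun _ _ => Finset.mem_univ _
      right_mem := fun _ _ => Finset.mem_univ _
      lt := fun i hi => (hnext i hi).2.1
      y_left := fun i hi => (hline i hi _).1 ((hmemE i).1 hi).1.2
      y_right := fun i hi => (hline i hi _).1 (hnext i hi).1
      not_inside := fun i hi p _ hp hy =>
        ((hnext i hi).2.2 p ((hline i hi _).2 hy) hp.1).not_gt hp.2
      simple := fun i hi j hj hl hr => by
        have h1 := (hline i hi _).1 ((hmemE i).1 hi).1.2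
        have h2 := (hline j hj _).1 ((hmemE j).1 hj).1.2
        have h3 := (hline i hi _).1 (hnext i hi).1
        have h4 := (hline j hj _).1 (hnext j hj).1
        change i.1 = j.1 at hl
        change next i = next j at hr
        rw [← hl] at h2
        rw [← hr] at h4
        obtain ⟨h5, h6⟩ := Drawing.slope_eq_icpt_eq (D := D) (i := i) (j := j)
          (hnext i hi).2.1.ne (h1.symm.trans h2) (h3.symm.trans h4)
        exact Prod.ext hl (hline_eq i hi j hj h5 h6) }
  have hcross : (D.crossings E).card ≤ L.card ^ 2 := by
    rw [sq, ← Finset.card_product]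
    refine Finset.card_le_card_of_injOn (fun p => (p.1.2, p.2.2)) (fun p hp => ?_)
      fun p hp q hq hpq => ?_
    · obtain ⟨h1, h2, -⟩ := Drawing.mem_crossings.1 hp
      exact Finset.mk_mem_product ((hmemE _).1 h1).1.1 ((hmemE _).1 h2).1.1
    · obtain ⟨hp1, hp2, hp⟩ := Drawing.mem_crossings.1 hp
      obtain ⟨hq1, hq2, hq⟩ := Drawing.mem_crossings.1 hq
      obtain ⟨h1, h2⟩ := Prod.mk.inj hpq
      have hne := hD.line_ne_of_cross hp1 hp2 hp
      obtain ⟨-, s, hs1, hs2, hs⟩ := hp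
      obtain ⟨-, s', hs1', hs2', hs'⟩ := hq
      have hm1 : D.slope q.1 = D.slope p.1 := congrArg m h1.symm
      have hm2 : D.slope q.2 = D.slope p.2 := congrArg m h2.symm
      have hk1 : D.icpt q.1 = D.icpt p.1 := congrArg k h1.symm
      have hk2 : D.icpt q.2 = D.icpt p.2 := congrArg k h2.symm
      have hss : s = s' := by
        by_contra hss
        refine hne (Drawing.slope_eq_icpt_eq hss hs ?_)
        simpa only [Drawing.height, hm1, hm2, hk1, hk2] using hs'
      subst hss
      exact Prod.ext (hD.eq_of_line_eq hp1 hq1 hm1.symm hk1.symm hs1 hs1')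
        (hD.eq_of_line_eq hp2 hq2 hm2.symm hk2.symm hs2 hs2')
  have hlast : (I \ E).card ≤ L.card := by
    refine Finset.card_le_card_of_injOn Prod.snd
      (fun i hi => ((hmemI i).1 (Finset.mem_sdiff.1 hi).1).1) fun i hi j hj hij => ?_
    obtain ⟨hi, hi'⟩ := Finset.mem_sdiff.1 hi
    obtain ⟨hj, hj'⟩ := Finset.mem_sdiff.1 hj
    rw [hmemI] at hi hj
    rw [hmemE] at hi' hj'
    refine Prod.ext (hinj _ _ (le_antisymm ?_ ?_)) hij
    · by_contra! hlt
      exact hj' ⟨hj, i.1, hij ▸ hi.2, hlt⟩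
    · by_contra! hlt
      exact hi' ⟨hi, j.1, hij ▸ hj.2, hlt⟩
  refine ⟨E.card, ?_, fun he => ?_⟩
  · have hsub : Incidences P L ⊆ I.image fun i => (i.1.1, i.2) := by
      rintro ⟨p, l⟩ ⟨hp, hl, hpl⟩
      exact Finset.mem_coe.2 (Finset.mem_image.2 ⟨(⟨p, hp⟩, l), (hmemI _).2 ⟨hl, hpl⟩, rfl⟩)
    have h1 := Set.ncard_le_ncard hsub (Finset.finite_toSet _)
    rw [Set.ncard_coe_finset] at h1
    have h2 : (I.image fun i => (i.1.1, i.2)).card ≤ I.card := Finset.card_image_le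
    have h3 : (I \ E).card + E.card = I.card :=
      Finset.card_sdiff_add_card_eq_card (Finset.filter_subset _ _)
    omega
  · have := hD.card_pow_three_le (by rwa [Fintype.card_coe])
    rw [Fintype.card_coe] at this
    exact this.trans (by gcongr)

/-- The Szemerédi–Trotter theorem: there is an absolute constant `C > 0` such that
`n` points and `m` lines in `ℝ²` determine at most `C (n^{2/3} m^{2/3} + n + m)`
incidences. -/
theorem szemeredi_trotter :
    ∃ C : ℝ, 0 < C ∧
      ∀ (P : Set (ℝ × ℝ)) (L : Set (Set (ℝ × ℝ))),
        P.Finite → L.Finite → (∀ l ∈ L, IsLine l) →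
        ((Incidences P L).ncard : ℝ) ≤
          C * ((P.ncard : ℝ) ^ ((2 : ℝ) / 3) * (L.ncard : ℝ) ^ ((2 : ℝ) / 3)
              + (P.ncard : ℝ) + (L.ncard : ℝ)) := by
  refine ⟨7, by norm_num, fun P L hP hL hlines => ?_⟩
  lift P to Finset (ℝ × ℝ) using hP
  lift L to Finset (Set (ℝ × ℝ)) using hL
  obtain ⟨e, hIe, he⟩ := exists_edges P L fun l hl => hlines l hl
  rw [Set.ncard_coe_finset, Set.ncard_coe_finset]
  have hIe' : ((Incidences P L).ncard : ℝ) ≤ e + (L.card : ℝ) := by exact_mod_cast hIe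
  have he' : 6 * (P.card : ℝ) ≤ e → (e : ℝ) ^ 3 ≤ 288 * (P.card : ℝ) ^ 2 * (L.card : ℝ) ^ 2 :=
    fun h => by exact_mod_cast he (by exact_mod_cast h)
  set n : ℝ := (P.card : ℝ)
  set m : ℝ := (L.card : ℝ)
  have hn : 0 ≤ n := Nat.cast_nonneg _
  have hm : 0 ≤ m := Nat.cast_nonneg _
  set a : ℝ := n ^ ((2 : ℝ) / 3) * m ^ ((2 : ℝ) / 3) with ha
  have ha0 : 0 ≤ a := by positivity
  have ha3 : a ^ 3 = n ^ 2 * m ^ 2 := by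
    have hcube : ∀ z : ℝ, 0 ≤ z → (z ^ ((2 : ℝ) / 3)) ^ 3 = z ^ 2 := fun z hz => by
      rw [← Real.rpow_natCast, ← Real.rpow_mul hz]
      norm_num
    rw [ha, mul_pow, hcube n hn, hcube m hm]
  rcases le_or_gt (6 * n) e with hle | hlt
  · have h3 := he' hle
    have : (e : ℝ) ≤ 7 * a := by
      refine le_of_pow_le_pow_left₀ three_ne_zero (by positivity) ?_
      rw [mul_pow, ha3]
      nlinarith [mul_nonneg (sq_nonneg n) (sq_nonneg m)]
    linarith
  · linarith
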